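/- Let λ > 0, K ∈ ℕ, and let Q_{λ,K} be the K-averaged dithered one-bit quantizer with independent dithers τ_1, …, τ_K uniformly distributed on [−λ,λ]^d. Then for any x ∈ ℝ^d with ‖x‖_∞ ≤ λ, the expectation over the dithers satisfies E[‖Q_{λ,K}(x) − x‖²] = (1/K)·(λ²·d − ‖x‖²), where ‖·‖ is the Euclidean norm. -/

import Mathlib

open MeasureTheory
open scoped NNReal

/-- Sign convention: `sgn s = 1` if `s ≥ 0`, `sgn s = -1` if `s < 0`. -/
noncomputable def sgn (s : ℝ) : ℝ := if 0 ≤ s then 1 else -1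

/-- The uniform probability measure on the interval `[-lam, lam]`. -/
noncomputable def unifIcc (lam : ℝ) : Measure ℝ :=
  ((Real.toNNReal (2 * lam))⁻¹ : ℝ≥0) • volume.restrict (Set.Icc (-lam) lam)

instance (lam : ℝ) : IsFiniteMeasure (unifIcc lam) := by
  unfold unifIcc; infer_instance

lemma measurable_sgn : Measurable sgn := by
  unfold sgn
  exact Measurable.ite measurableSet_Ici measurable_const measurable_const

lemma sgn_abs_le (s : ℝ) : ‖sgn s‖ ≤ 1 := by
  unfold sgn; split_ifs <;> simp

lemma sgn_sq (s : ℝ) : sgn s ^ 2 = 1 := by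
  unfold sgn; split_ifs <;> simp

lemma isProb_unifIcc (lam : ℝ) (hlam : 0 < lam) : IsProbabilityMeasure (unifIcc lam) := by
  constructor
  have h : (0:ℝ) < 2 * lam := by linarith
  have h2 : lam - -lam = 2 * lam := by ring
  unfold unifIcc
  rw [Measure.smul_apply, Measure.restrict_apply_univ, Real.volume_Icc, h2, ENNReal.smul_def,
    smul_eq_mul, ENNReal.ofReal, ENNReal.coe_inv (by simpa using h)]
  exact ENNReal.inv_mul_cancel (by simpa using h) (by simp)

lemma integrable_sgn (lam y : ℝ) : Integrable (fun t => sgn (y + t)) (unifIcc lam) :=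
  Integrable.of_bound (measurable_sgn.comp (measurable_const_add y)).aestronglyMeasurable 1
    (Filter.Eventually.of_forall fun t => sgn_abs_le _)

lemma integral_sgn (lam : ℝ) (hlam : 0 < lam) (y : ℝ) (hy : |y| ≤ lam) :
    ∫ t, sgn (y + t) ∂(unifIcc lam) = y / lam := by
  have := isProb_unifIcc lam hlam
  obtain ⟨h1, h2⟩ := abs_le.1 hy
  have e : (fun t => sgn (y + t)) = fun t => 2 * (Set.Ici (-y)).indicator 1 t - 1 := by
    funext t
    by_cases h : -y ≤ t
    · have h' : 0 ≤ y + t := by linarith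
      simp [sgn, h, h']; norm_num
    · have h' : ¬ 0 ≤ y + t := by intro h'; apply h; linarith
      simp [sgn, h, h']
  have hm : (unifIcc lam).real (Set.Ici (-y)) = (lam + y) / (2 * lam) := by
    have hi : Set.Ici (-y) ∩ Set.Icc (-lam) lam = Set.Icc (-y) lam := by
      ext t; simp only [Set.mem_inter_iff, Set.mem_Ici, Set.mem_Icc]
      constructor
      · rintro ⟨a, b, c⟩; exact ⟨a, c⟩
      · rintro ⟨a, b⟩; exact ⟨a, by linarith, b⟩
    unfold unifIcc
    rw [measureReal_nnreal_smul_apply, measureReal_restrict_apply measurableSet_Ici, hi,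
      Real.volume_real_Icc_of_le (by linarith), NNReal.coe_inv, Real.coe_toNNReal _ (by linarith)]
    rw [sub_neg_eq_add]; ring
  have hIntegrable : Integrable (fun t => 2 * (Set.Ici (-y)).indicator (1 : ℝ → ℝ) t) (unifIcc lam) :=
    ((integrable_const (1:ℝ)).indicator measurableSet_Ici).const_mul 2
  rw [e, integral_sub hIntegrable (integrable_const _), integral_const_mul, integral_indicator_one measurableSet_Ici, hm]
  simp
  field_simp
  ring

/-- for the `K`-averaged dithered one-bit quantizer
`Q_{λ,K}(x) = (λ/K)·Σ_{i=1}^K sign (x + τ i)` with independent dithers uniformly distributed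
on `[−λ,λ]^d`, and any `x` with `‖x‖_∞ ≤ λ`, the expectation over the dithers satisfies
`E‖Q_{λ,K}(x) − x‖² = (1/K)·(λ²·d − ‖x‖²)` (Euclidean norm). -/
theorem expected_sq_error_K_averaged_dithered_quantizer (d K : ℕ) (hK : 0 < K)
    (lam : ℝ) (hlam : 0 < lam) (x : Fin d → ℝ) (hx : ∀ j : Fin d, |x j| ≤ lam) :
    (∫ τ : Fin K → Fin d → ℝ,
        ∑ j : Fin d, ((lam / K) * (∑ i : Fin K, sgn (x j + τ i j)) - x j) ^ 2
        ∂(Measure.pi fun _ : Fin K => Measure.pi fun _ : Fin d => unifIcc lam)) =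
      (1 / K) * (lam ^ 2 * d - ∑ j : Fin d, (x j) ^ 2) := by
  have hP := isProb_unifIcc lam hlam
  have hK' : (K : ℝ) ≠ 0 := by exact_mod_cast hK.ne'
  set μ : Measure (Fin d → ℝ) := Measure.pi fun _ : Fin d => unifIcc lam with hμ
  have hfm : ∀ j, Measurable (fun v : Fin d → ℝ => lam * sgn (x j + v j) - x j) := fun j => by
    have h : Measurable (fun v : Fin d → ℝ => x j + v j) := by fun_prop
    exact ((measurable_sgn.comp h).const_mul lam).sub_const _
  have hgm : ∀ y, Measurable (fun t : ℝ => sgn (y + t)) := fun y =>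
    measurable_sgn.comp (measurable_const_add y)
  have hfL : ∀ j, MemLp (fun v : Fin d → ℝ => lam * sgn (x j + v j) - x j) 2 μ := fun j =>
    MemLp.of_bound (hfm j).aestronglyMeasurable (lam + |x j|)
      (Filter.Eventually.of_forall fun v => by
        refine (norm_sub_le _ _).trans ?_
        have := sgn_abs_le (x j + v j)
        rw [norm_mul, Real.norm_of_nonneg hlam.le, Real.norm_eq_abs (x j)]
        nlinarith)
  have h0 : ∀ j, ∫ v, (lam * sgn (x j + v j) - x j) ∂μ = 0 := fun j => by
    rw [hμ, integral_comp_eval (μ := fun _ : Fin d => unifIcc lam) (i := j)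
      (f := fun t => lam * sgn (x j + t) - x j)
      (((hgm _).const_mul lam).sub_const _).aestronglyMeasurable,
      integral_sub ((integrable_sgn _ _).const_mul _) (integrable_const _), integral_const_mul,
      integral_sgn lam hlam _ (hx j)]
    simp
    field_simp
    ring
  have h1 : ∀ j, ∫ v, (lam * sgn (x j + v j) - x j) ^ 2 ∂μ = lam ^ 2 - x j ^ 2 := fun j => by
    rw [hμ, integral_comp_eval (μ := fun _ : Fin d => unifIcc lam) (i := j)
      (f := fun t => (lam * sgn (x j + t) - x j) ^ 2)
      ((((hgm _).const_mul lam).sub_const _).pow_const 2).aestronglyMeasurable]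
    have e : ∀ t, (lam * sgn (x j + t) - x j) ^ 2
        = (lam ^ 2 + x j ^ 2) - (2 * lam * x j) * sgn (x j + t) := fun t => by
      linear_combination lam ^ 2 * sgn_sq (x j + t)
    simp_rw [e]
    rw [integral_sub (integrable_const _) ((integrable_sgn _ _).const_mul _), integral_const_mul,
      integral_sgn lam hlam _ (hx j)]
    simp
    field_simp
    ring
  have hSL : ∀ j, MemLp (fun τ : Fin K → Fin d → ℝ => ∑ i, (lam * sgn (x j + τ i j) - x j)) 2
      (Measure.pi fun _ : Fin K => μ) := fun j =>
    memLp_finsetSum _ fun i _ =>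
      (hfL j).comp_measurePreserving (measurePreserving_eval (fun _ : Fin K => μ) i)
  have hS0 : ∀ j, ∫ τ : Fin K → Fin d → ℝ, ∑ i, (lam * sgn (x j + τ i j) - x j)
      ∂(Measure.pi fun _ : Fin K => μ) = 0 := fun j => by
    rw [integral_finsetSum]
    · refine Finset.sum_eq_zero fun i _ => ?_
      rw [integral_comp_eval (μ := fun _ : Fin K => μ) (i := i)
        (f := fun v => lam * sgn (x j + v j) - x j) (hfm j).aestronglyMeasurable, h0]
    · intro i _
      exact ((hfL j).comp_measurePreserving
        (measurePreserving_eval (fun _ : Fin K => μ) i)).integrable (by norm_num)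
  have hS : ∀ j, ∫ τ : Fin K → Fin d → ℝ, (∑ i, (lam * sgn (x j + τ i j) - x j)) ^ 2
      ∂(Measure.pi fun _ : Fin K => μ) = K * (lam ^ 2 - x j ^ 2) := fun j => by
    rw [← ProbabilityTheory.variance_of_integral_eq_zero
      (hSL j).aestronglyMeasurable.aemeasurable (hS0 j)]
    have := ProbabilityTheory.variance_sum_pi (μ := fun _ : Fin K => μ)
      (X := fun _ v => lam * sgn (x j + v j) - x j) (fun _ => hfL j)
    rw [ProbabilityTheory.variance_of_integral_eq_zero (hfm j).aemeasurable (h0 j), h1] at this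
    simp only [Finset.sum_const, Finset.card_univ, Fintype.card_fin, nsmul_eq_mul] at this
    rw [← this]
    congr 1
    funext τ
    simp
  have e : ∀ (τ : Fin K → Fin d → ℝ) j, ((lam / K) * (∑ i : Fin K, sgn (x j + τ i j)) - x j) ^ 2
      = (1 / (K:ℝ) ^ 2) * (∑ i, (lam * sgn (x j + τ i j) - x j)) ^ 2 := fun τ j => by
    rw [Finset.sum_sub_distrib, ← Finset.mul_sum]
    simp only [Finset.sum_const, Finset.card_univ, Fintype.card_fin, nsmul_eq_mul]
    field_simp
  simp_rw [e]
  rw [integral_finsetSum _ fun j _ => ((hSL j).integrable_sq).const_mul _]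
  simp_rw [integral_const_mul, hS]
  rw [← Finset.mul_sum, ← Finset.mul_sum, Finset.sum_sub_distrib]
  simp only [Finset.sum_const, Finset.card_univ, Fintype.card_fin, nsmul_eq_mul]
  field_simp
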